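/- arXiv:2107.05793 — 2 statements merged into one kernel-verified Lean document; each statement's English description precedes it below -/
import Mathlib

section
/- Let G = (V, E) be a finite simple graph, b : V → ℕ degree bounds, M = {e₁, …, e_k} a maximal b-matching (no edge of E \ M is available with respect to M) with an ordering of its edges such that each e_i is available with respect to M_{i-1} = {e₁, …, e_{i-1}}, and let M* be any b-matching of G. Then there exist pairwise disjoint sets M*₁, …, M*_k whose union is M*, such that for each i: |M*_i| ≤ 2, and every edge e* ∈ M*_i is available with respect to M_{i-1} and satisfies e* = e_i or e* is adjacent to e_i. -/
/-- `M` is a `b`-matching of the simple graph `G`: a set of edges of `G` such that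
every vertex `v` is incident to at most `b v` edges of `M`. -/
def IsBMatching {V : Type*} [Fintype V] [DecidableEq V] (G : SimpleGraph V)
    [DecidableRel G.Adj] (b : V → ℕ) (M : Finset (Sym2 V)) : Prop :=
  M ⊆ G.edgeFinset ∧ ∀ v : V, (M.filter (fun e => v ∈ e)).card ≤ b v

/-- An edge `e ∈ E` is available with respect to `M` if `e ∉ M` and `M ∪ {e}`
is a `b`-matching. -/
def AvailableEdge {V : Type*} [Fintype V] [DecidableEq V] (G : SimpleGraph V)
    [DecidableRel G.Adj] (b : V → ℕ) (M : Finset (Sym2 V)) (e : Sym2 V) : Prop :=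
  e ∈ G.edgeFinset ∧ e ∉ M ∧ IsBMatching G b (M ∪ {e})

/-- Two distinct edges are adjacent if they share an endpoint. -/
def EdgeAdjacent {V : Type*} (e e' : Sym2 V) : Prop :=
  e ≠ e' ∧ ∃ v : V, v ∈ e ∧ v ∈ e'

/-- The set of the first `i` edges of the ordering `e : Fin k → Sym2 V`. -/
def prefixSet {V : Type*} [DecidableEq V] {k : ℕ} (e : Fin k → Sym2 V) (i : ℕ) :
    Finset (Sym2 V) :=
  (Finset.univ.filter (fun j : Fin k => (j : ℕ) < i)).image e

theorem IsBMatching.mono {V : Type*} [Fintype V] [DecidableEq V] {G : SimpleGraph V}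
    [DecidableRel G.Adj] {b : V → ℕ} {S M : Finset (Sym2 V)} (hM : IsBMatching G b M)
    (hS : S ⊆ M) : IsBMatching G b S :=
  ⟨hS.trans hM.1, fun v => (Finset.card_le_card (Finset.filter_subset_filter _ hS)).trans (hM.2 v)⟩

/-- A new edge that is not available has a saturated endpoint. -/
theorem IsBMatching.exists_saturated_of_not_availableEdge {V : Type*} [Fintype V] [DecidableEq V]
    {G : SimpleGraph V} [DecidableRel G.Adj] {b : V → ℕ} {S : Finset (Sym2 V)}
    (hS : IsBMatching G b S) {x : Sym2 V} (hx : x ∈ G.edgeFinset) (hxS : x ∉ S)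
    (hn : ¬ AvailableEdge G b S x) : ∃ v ∈ x, b v ≤ (S.filter (fun e => v ∈ e)).card := by
  by_contra! h
  refine hn ⟨hx, hxS, Finset.union_subset hS.1 (Finset.singleton_subset_iff.2 hx), fun v => ?_⟩
  rw [Finset.filter_union, Finset.filter_singleton]
  split_ifs with hv
  · exact (Finset.card_union_le _ _).trans (h v hv)
  · simpa using hS.2 v

theorem prefixSet_subset_image {V : Type*} [DecidableEq V] {k : ℕ} (e : Fin k → Sym2 V) (i : ℕ) :
    prefixSet e i ⊆ Finset.univ.image e :=
  Finset.image_subset_image (Finset.filter_subset _ _)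

theorem prefixSet_self {V : Type*} [DecidableEq V] {k : ℕ} (e : Fin k → Sym2 V) :
    prefixSet e k = Finset.univ.image e := by
  simp [prefixSet]

/-- An edge outside the maximal `b`-matching has an endpoint `v`, saturated by the matching, such
that the edge is available just before each matching edge at `v` is added. -/
theorem exists_saturated_endpoint {V : Type*} [Fintype V] [DecidableEq V]
    {G : SimpleGraph V} [DecidableRel G.Adj] {b : V → ℕ} {k : ℕ} {e : Fin k → Sym2 V}
    (he : Function.Injective e) (hMb : IsBMatching G b (Finset.univ.image e)) {x : Sym2 V}
    (hmax : ¬ AvailableEdge G b (Finset.univ.image e) x)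
    (hx : x ∈ G.edgeFinset) (hxM : x ∉ Finset.univ.image e) :
    ∃ v ∈ x, b v ≤ ((Finset.univ.image e).filter (fun y => v ∈ y)).card ∧
      ∀ j : Fin k, v ∈ e j → AvailableEdge G b (prefixSet e j) x := by
  classical
  have hex : ∃ t, ¬ AvailableEdge G b (prefixSet e t) x := ⟨k, by rwa [prefixSet_self]⟩
  have hsub := prefixSet_subset_image e (Nat.find hex)
  obtain ⟨v, hv, hbv⟩ := (hMb.mono hsub).exists_saturated_of_not_availableEdge hx
    (fun h => hxM (hsub h)) (Nat.find_spec hex)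
  refine ⟨v, hv, hbv.trans (Finset.card_le_card (Finset.filter_subset_filter _ hsub)),
    fun j hj => ?_⟩
  by_contra hn
  have hjt : e j ∉ prefixSet e (Nat.find hex) := by
    intro h
    obtain ⟨l, hl, hlj⟩ := Finset.mem_image.1 h
    obtain rfl := he hlj
    exact Nat.find_min hex (Finset.mem_filter.1 hl).2 hn
  have hlt : ((prefixSet e (Nat.find hex)).filter (fun y => v ∈ y)).card <
      ((Finset.univ.image e).filter (fun y => v ∈ y)).card := by
    refine Finset.card_lt_card ⟨Finset.filter_subset_filter _ hsub, fun h => hjt ?_⟩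
    exact (Finset.mem_filter.1 (h (Finset.mem_filter.2
      ⟨Finset.mem_image_of_mem e (Finset.mem_univ j), hj⟩))).1
  exact absurd (hMb.2 v) (by omega)

theorem Finset.exists_mapsTo_injOn_of_card_le {α : Type*} {s t : Finset α}
    (h : s.card ≤ t.card) : ∃ g : α → α, (∀ x ∈ s, g x ∈ t) ∧ Set.InjOn g s := by
  classical
  obtain ⟨φ⟩ : Nonempty (s ↪ t) := Function.Embedding.nonempty_of_card_le (by simpa using h)
  refine ⟨fun x => if hx : x ∈ s then φ ⟨x, hx⟩ else x, fun x hx => by simp [hx], ?_⟩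
  intro x hx y hy hxy
  have hx' : x ∈ s := hx
  have hy' : y ∈ s := hy
  simp only [hx', hy', dif_pos] at hxy
  exact congrArg Subtype.val (φ.injective (Subtype.ext hxy))

/-- If each `x ∈ T \ M` is assigned an endpoint `f x` at which `M` has at least as many edges as
`T`, then the elements of `T \ M` can be sent to edges of `M \ T` through the assigned endpoints,
injectively at each endpoint. -/
theorem exists_charge {V : Type*} [DecidableEq V] (M T : Finset (Sym2 V)) (f : Sym2 V → V)
    (hf : ∀ x ∈ T \ M, f x ∈ x ∧
      (T.filter (fun y => f x ∈ y)).card ≤ (M.filter (fun y => f x ∈ y)).card) :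
    ∃ h : Sym2 V → Sym2 V, (∀ x ∈ T \ M, h x ∈ M \ T ∧ f x ∈ h x) ∧
      ∀ x ∈ T \ M, ∀ y ∈ T \ M, f x = f y → h x = h y → x = y := by
  have key : ∀ v, ∃ g : Sym2 V → Sym2 V,
      (∀ x ∈ (T \ M).filter (fun x => f x = v), g x ∈ (M \ T).filter (fun y => v ∈ y)) ∧
      Set.InjOn g ((T \ M).filter (fun x => f x = v)) := by
    intro v
    apply Finset.exists_mapsTo_injOn_of_card_le
    obtain hE | ⟨x, hx⟩ := ((T \ M).filter (fun x => f x = v)).eq_empty_or_nonempty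
    · simp [hE]
    obtain ⟨hxs, rfl⟩ := Finset.mem_filter.1 hx
    have hsub : (T \ M).filter (fun y => f y = f x) ⊆
        T.filter (fun y => f x ∈ y) \ M.filter (fun y => f x ∈ y) := by
      intro y hy
      obtain ⟨hy, hyx⟩ := Finset.mem_filter.1 hy
      have := (hf y hy).1
      rw [Finset.mem_sdiff] at hy
      simp_all
    have heq : (M \ T).filter (fun y => f x ∈ y) =
        M.filter (fun y => f x ∈ y) \ T.filter (fun y => f x ∈ y) := by
      ext y
      simp only [Finset.mem_filter, Finset.mem_sdiff]
      tauto
    rw [heq]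
    exact (Finset.card_le_card hsub).trans (Finset.card_sdiff_le_card_sdiff_iff.2 (hf x hxs).2)
  choose g hg hinj using key
  refine ⟨fun x => g (f x) x, fun x hx => ?_, fun x hx y hy hxy hgxy => ?_⟩
  · exact Finset.mem_filter.1 (hg (f x) x (Finset.mem_filter.2 ⟨hx, rfl⟩))
  · refine hinj (f x) (Finset.mem_filter.2 ⟨hx, rfl⟩) (Finset.mem_filter.2 ⟨hy, hxy.symm⟩) ?_
    simpa only [← hxy] using hgxy

/-- **the charging argument.** Given a maximal `b`-matching
`M = {e₁, …, e_k}`, built by an ordering in which each `e_i` is available w.r.t.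
`M_{i-1}`, and any `b`-matching `M*`, the optimal matching `M*` can be partitioned
into pairwise disjoint sets `M*₁, …, M*_k` with `|M*_i| ≤ 2`, such that every edge
`e* ∈ M*_i` is available w.r.t. `M_{i-1}` and equals `e_i` or is adjacent to `e_i`. -/
theorem charging_partition_exists {V : Type*} [Fintype V] [DecidableEq V]
    (G : SimpleGraph V) [DecidableRel G.Adj] (b : V → ℕ)
    (k : ℕ) (e : Fin k → Sym2 V) (he : Function.Injective e)
    (M : Finset (Sym2 V)) (hM : M = Finset.univ.image e)
    (hMb : IsBMatching G b M)
    (hMmax : ∀ e' : Sym2 V, ¬ AvailableEdge G b M e')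
    (ha : ∀ i : Fin k, AvailableEdge G b (prefixSet e (i : ℕ)) (e i))
    (Mstar : Finset (Sym2 V)) (hMstar : IsBMatching G b Mstar) :
    ∃ P : Fin k → Finset (Sym2 V),
      (∀ i j : Fin k, i ≠ j → Disjoint (P i) (P j)) ∧
      (Finset.univ.biUnion P = Mstar) ∧
      (∀ i : Fin k, (P i).card ≤ 2) ∧
      (∀ i : Fin k, ∀ e' ∈ P i,
        AvailableEdge G b (prefixSet e (i : ℕ)) e' ∧
          (e' = e i ∨ EdgeAdjacent (e i) e')) := by
  classical
  subst hM
  have hsat : ∀ x : Sym2 V, ∃ v, x ∈ Mstar \ Finset.univ.image e → v ∈ x ∧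
      b v ≤ ((Finset.univ.image e).filter (fun y => v ∈ y)).card ∧
      ∀ j : Fin k, v ∈ e j → AvailableEdge G b (prefixSet e j) x := by
    intro x
    by_cases hx : x ∈ Mstar \ Finset.univ.image e
    · obtain ⟨hxs, hxM⟩ := Finset.mem_sdiff.1 hx
      obtain ⟨v, hv⟩ := exists_saturated_endpoint he hMb (hMmax x) (hMstar.1 hxs) hxM
      exact ⟨v, fun _ => hv⟩
    · exact ⟨(Quot.out x).1, fun h => absurd h hx⟩
  choose f hf using hsat
  obtain ⟨h, hh, hinj⟩ := exists_charge (Finset.univ.image e) Mstar f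
    fun x hx => ⟨(hf x hx).1, (hMstar.2 _).trans (hf x hx).2.1⟩
  set c : Sym2 V → Sym2 V := fun x => if x ∈ Finset.univ.image e then x else h x with hc
  have hcM : ∀ x ∈ Mstar, c x ∈ Finset.univ.image e := by
    intro x hx
    by_cases hxM : x ∈ Finset.univ.image e
    · simpa only [hc, if_pos hxM] using hxM
    · simpa only [hc, if_neg hxM] using
        (Finset.mem_sdiff.1 (hh x (Finset.mem_sdiff.2 ⟨hx, hxM⟩)).1).1
  have hP : ∀ i, ∀ x ∈ Mstar.filter (fun x => c x = e i),
      x = e i ∨ (x ∈ Mstar \ Finset.univ.image e ∧ h x = e i) := by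
    intro i x hx
    obtain ⟨hx, hxi⟩ := Finset.mem_filter.1 hx
    by_cases hxM : x ∈ Finset.univ.image e
    · exact Or.inl (by simpa only [hc, if_pos hxM] using hxi)
    · exact Or.inr ⟨Finset.mem_sdiff.2 ⟨hx, hxM⟩, by simpa only [hc, if_neg hxM] using hxi⟩
  refine ⟨fun i => Mstar.filter (fun x => c x = e i), fun i j hij => ?_, ?_, fun i => ?_,
    fun i x hx => ?_⟩
  · refine Finset.disjoint_filter.2 fun x _ hi hj => hij (he (hi.symm.trans hj))
  · ext x
    simp only [Finset.mem_biUnion, Finset.mem_univ, true_and, Finset.mem_filter]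
    refine ⟨fun ⟨_, hx, _⟩ => hx, fun hx => ?_⟩
    obtain ⟨i, -, hi⟩ := Finset.mem_image.1 (hcM x hx)
    exact ⟨i, hx, hi.symm⟩
  · by_cases hi : e i ∈ Mstar
    · refine (Finset.card_le_card (t := {e i}) fun x hx => ?_).trans (by simp)
      obtain rfl | ⟨hx, hxi⟩ := hP i x hx
      · simp
      · exact absurd (hxi ▸ hi) (Finset.mem_sdiff.1 (hh x hx).1).2
    · have hP' : ∀ x ∈ Mstar.filter (fun x => c x = e i),
          x ∈ Mstar \ Finset.univ.image e ∧ h x = e i := fun x hx =>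
        (hP i x hx).resolve_left fun hxi => hi (hxi ▸ (Finset.mem_filter.1 hx).1)
      have hle : (Mstar.filter (fun x => c x = e i)).card ≤ (e i).toFinset.card := by
        refine Finset.card_le_card_of_injOn f (fun x hx => ?_) fun x hx y hy hxy => ?_
        · obtain ⟨hx, hxi⟩ := hP' x hx
          exact Sym2.mem_toFinset.2 (hxi ▸ (hh x hx).2)
        · obtain ⟨hx, hxi⟩ := hP' x hx
          obtain ⟨hy, hyi⟩ := hP' y hy
          exact hinj x hx y hy hxy (hxi.trans hyi.symm)
      refine hle.trans ?_
      rw [Sym2.card_toFinset]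
      split_ifs <;> omega
  · obtain rfl | ⟨hx, hxi⟩ := hP i x hx
    · exact ⟨ha i, Or.inl rfl⟩
    · have hfi : f x ∈ e i := hxi ▸ (hh x hx).2
      refine ⟨(hf x hx).2.2 i hfi, Or.inr ⟨?_, f x, hfi, (hf x hx).1⟩⟩
      rintro rfl
      exact (Finset.mem_sdiff.1 hx).2 (Finset.mem_image_of_mem e (Finset.mem_univ i))
end

section
/- Let G = (V, E) be a finite simple graph, b : V → ℕ degree bounds, and f a normalized monotone submodular real-valued function on subsets of E. Let M = {e₁, …, e_k} be a maximal b-matching (no edge of E \ M is available with respect to M) admitting an ordering of its edges such that, for each i with M_{i-1} = {e₁, …, e_{i-1}}: (a) e_i is available with respect to M_{i-1}, and (b) for every edge e' adjacent to e_i that is available with respect to M_{i-1}, ρ_{e_i}(M_{i-1}) ≥ ρ_{e'}(M_{i-1}). Then for every b-matching M* of G, f(M) ≥ (1/3) · f(M*). -/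
theorem IsBMatching.subset {V : Type*} [Fintype V] [DecidableEq V] {G : SimpleGraph V}
    [DecidableRel G.Adj] {b : V → ℕ} {A B : Finset (Sym2 V)} (hB : IsBMatching G b B)
    (h : A ⊆ B) : IsBMatching G b A :=
  ⟨h.trans hB.1, fun v => (Finset.card_le_card (Finset.filter_subset_filter _ h)).trans (hB.2 v)⟩

theorem prefixSet_zero {V : Type*} [DecidableEq V] {k : ℕ} (e : Fin k → Sym2 V) :
    prefixSet e 0 = ∅ := by
  simp [prefixSet]

theorem prefixSet_succ {V : Type*} [DecidableEq V] {k : ℕ} (e : Fin k → Sym2 V) (i : Fin k) :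
    prefixSet e (i + 1) = prefixSet e i ∪ {e i} := by
  ext x
  simp only [prefixSet, Finset.mem_image, Finset.mem_filter, Finset.mem_univ, true_and,
    Finset.mem_union, Finset.mem_singleton]
  constructor
  · rintro ⟨j, hj, rfl⟩
    rcases Nat.lt_succ_iff_lt_or_eq.1 hj with h | h
    · exact Or.inl ⟨j, h, rfl⟩
    · exact Or.inr (congrArg e (Fin.ext h))
  · rintro (⟨j, hj, rfl⟩ | rfl)
    · exact ⟨j, by omega, rfl⟩
    · exact ⟨i, by omega, rfl⟩

/-- If `e` is available with respect to a subset `S` of the `b`-matching `N` and dominates its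
available neighbours, then room for `e` at an endpoint `w` can be made inside `N`, keeping `S`,
at a cost of at most the marginal gain of `e`. -/
theorem exists_subset_degree_lt {V : Type*} [Fintype V] [DecidableEq V] {G : SimpleGraph V}
    [DecidableRel G.Adj] {b : V → ℕ} {f : Finset (Sym2 V) → ℝ}
    (hmono : ∀ A B : Finset (Sym2 V), A ⊆ B → B ⊆ G.edgeFinset → f A ≤ f B)
    (hsub : ∀ A B : Finset (Sym2 V), A ⊆ B → B ⊆ G.edgeFinset →
      ∀ e ∈ G.edgeFinset, e ∉ B → f (B ∪ {e}) - f B ≤ f (A ∪ {e}) - f A)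
    {S N : Finset (Sym2 V)} {e : Sym2 V} (hN : IsBMatching G b N) (hSN : S ⊆ N) (heN : e ∉ N)
    (ha : AvailableEdge G b S e)
    (hb : ∀ e' : Sym2 V, EdgeAdjacent e e' → AvailableEdge G b S e' →
      f (S ∪ {e'}) - f S ≤ f (S ∪ {e}) - f S)
    {w : V} (hw : w ∈ e) :
    ∃ N' ⊆ N, S ⊆ N' ∧ (N'.filter (fun x => w ∈ x)).card < b w ∧
      f (N ∪ {e}) ≤ f (N' ∪ {e}) + (f (S ∪ {e}) - f S) := by
  obtain ⟨heE, heS, hSe⟩ := ha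
  by_cases hlt : (N.filter (fun x => w ∈ x)).card < b w
  · refine ⟨N, subset_rfl, hSN, hlt, ?_⟩
    linarith [hmono S (S ∪ {e}) Finset.subset_union_left hSe.1]
  have hcard : (S.filter (fun x => w ∈ x)).card < (N.filter (fun x => w ∈ x)).card := by
    have h := hSe.2 w
    rw [Finset.filter_union, Finset.filter_singleton, if_pos hw,
      Finset.card_union_of_disjoint (by simp [heS]), Finset.card_singleton] at h
    omega
  obtain ⟨o, hoN, hoS⟩ := Finset.exists_mem_notMem_of_card_lt_card hcard
  obtain ⟨hoN, hwo⟩ := Finset.mem_filter.1 hoN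
  have hoS : o ∉ S := fun h => hoS (Finset.mem_filter.2 ⟨h, hwo⟩)
  have hoe : e ≠ o := fun h => heN (h ▸ hoN)
  have hSo : IsBMatching G b (S ∪ {o}) :=
    hN.subset (Finset.union_subset hSN (Finset.singleton_subset_iff.2 hoN))
  have hSN' : S ⊆ N.erase o := Finset.subset_erase.2 ⟨hSN, hoS⟩
  refine ⟨N.erase o, Finset.erase_subset _ _, hSN', ?_, ?_⟩
  · rw [Finset.filter_erase]
    exact (Finset.card_erase_lt_of_mem (Finset.mem_filter.2 ⟨hoN, hwo⟩)).trans_le (hN.2 w)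
  · have hgain := hb o ⟨hoe, w, hw, hwo⟩ ⟨hN.1 hoN, hoS, hSo⟩
    have hdim := hsub S (N.erase o ∪ {e}) (hSN'.trans Finset.subset_union_left)
      (Finset.union_subset ((Finset.erase_subset _ _).trans hN.1)
        (Finset.singleton_subset_iff.2 heE)) o (hN.1 hoN) (by simp [hoe.symm])
    have hun : N.erase o ∪ {e} ∪ {o} = N ∪ {e} := by
      rw [Finset.union_right_comm, Finset.union_comm (N.erase o), ← Finset.insert_eq,
        Finset.insert_erase hoN]
    rw [hun] at hdim
    linarith

/-- A `b`-matching containing `S` can be modified so as to contain a locally dominant edge `e` as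
well, at a cost of at most twice the marginal gain of `e`. -/
theorem IsBMatching.exists_exchange {V : Type*} [Fintype V] [DecidableEq V] {G : SimpleGraph V}
    [DecidableRel G.Adj] {b : V → ℕ} {f : Finset (Sym2 V) → ℝ}
    (hmono : ∀ A B : Finset (Sym2 V), A ⊆ B → B ⊆ G.edgeFinset → f A ≤ f B)
    (hsub : ∀ A B : Finset (Sym2 V), A ⊆ B → B ⊆ G.edgeFinset →
      ∀ e ∈ G.edgeFinset, e ∉ B → f (B ∪ {e}) - f B ≤ f (A ∪ {e}) - f A)
    {S N : Finset (Sym2 V)} {e : Sym2 V} (hN : IsBMatching G b N) (hSN : S ⊆ N)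
    (ha : AvailableEdge G b S e)
    (hb : ∀ e' : Sym2 V, EdgeAdjacent e e' → AvailableEdge G b S e' →
      f (S ∪ {e'}) - f S ≤ f (S ∪ {e}) - f S) :
    ∃ N', IsBMatching G b N' ∧ S ∪ {e} ⊆ N' ∧ f N ≤ f N' + 2 * (f (S ∪ {e}) - f S) := by
  by_cases heN : e ∈ N
  · refine ⟨N, hN, Finset.union_subset hSN (Finset.singleton_subset_iff.2 heN), ?_⟩
    linarith [hmono S (S ∪ {e}) Finset.subset_union_left ha.2.2.1]
  induction e using Sym2.ind with | _ u v
  obtain ⟨N₁, hN₁, hS₁, hu, hf₁⟩ :=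
    exists_subset_degree_lt hmono hsub hN hSN heN ha hb (Sym2.mem_mk_left u v)
  obtain ⟨N₂, hN₂, hS₂, hv, hf₂⟩ :=
    exists_subset_degree_lt hmono hsub (hN.subset hN₁) hS₁ (fun h => heN (hN₁ h)) ha hb
      (Sym2.mem_mk_right u v)
  have he : {s(u, v)} ⊆ G.edgeFinset := Finset.singleton_subset_iff.2 ha.1
  refine ⟨N₂ ∪ {s(u, v)}, ⟨Finset.union_subset ((hN₂.trans hN₁).trans hN.1) he, fun x => ?_⟩,
    Finset.union_subset_union_left hS₂, ?_⟩
  · rw [Finset.filter_union, Finset.filter_singleton]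
    split_ifs with hx
    · refine (Finset.card_union_le _ _).trans ?_
      rw [Finset.card_singleton]
      rcases Sym2.mem_iff.1 hx with rfl | rfl
      · exact (Finset.card_le_card (Finset.filter_subset_filter _ hN₂)).trans_lt hu
      · exact hv
    · rw [Finset.union_empty]
      exact (hN.subset (hN₂.trans hN₁)).2 x
  · linarith [hmono N (N ∪ {s(u, v)}) Finset.subset_union_left (Finset.union_subset hN.1 he)]

/-- Any maximal `b`-matching `M = {e₁, …, e_k}` that is
locally dominant with respect to a normalized monotone submodular function `f`
satisfies `f(M) ≥ (1/3) · f(M*)` for every `b`-matching `M*`. -/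
theorem locallyDominant_one_third_approx {V : Type*} [Fintype V] [DecidableEq V]
    (G : SimpleGraph V) [DecidableRel G.Adj] (b : V → ℕ)
    (f : Finset (Sym2 V) → ℝ)
    (hnorm : f ∅ = 0)
    (hmono : ∀ A B : Finset (Sym2 V), A ⊆ B → B ⊆ G.edgeFinset → f A ≤ f B)
    (hsub : ∀ A B : Finset (Sym2 V), A ⊆ B → B ⊆ G.edgeFinset →
      ∀ e ∈ G.edgeFinset, e ∉ B → f (B ∪ {e}) - f B ≤ f (A ∪ {e}) - f A)
    (k : ℕ) (e : Fin k → Sym2 V) (he : Function.Injective e)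
    (M : Finset (Sym2 V)) (hM : M = Finset.univ.image e)
    (hMmax : ∀ e' : Sym2 V, ¬ AvailableEdge G b M e')
    (ha : ∀ i : Fin k, AvailableEdge G b (prefixSet e (i : ℕ)) (e i))
    (hb : ∀ i : Fin k, ∀ e' : Sym2 V, EdgeAdjacent (e i) e' →
      AvailableEdge G b (prefixSet e (i : ℕ)) e' →
      f (prefixSet e (i : ℕ) ∪ {e'}) - f (prefixSet e (i : ℕ)) ≤
        f (prefixSet e (i : ℕ) ∪ {e i}) - f (prefixSet e (i : ℕ)))
    (Mstar : Finset (Sym2 V)) (hMstar : IsBMatching G b Mstar) :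
    (1 / 3 : ℝ) * f Mstar ≤ f M := by
  have key : ∀ i ≤ k, ∃ N, IsBMatching G b N ∧ prefixSet e i ⊆ N ∧
      f Mstar ≤ f N + 2 * f (prefixSet e i) := by
    intro i
    induction i with
    | zero =>
      exact fun _ => ⟨Mstar, hMstar, by simp [prefixSet_zero], by simp [prefixSet_zero, hnorm]⟩
    | succ i ih =>
      intro hi
      obtain ⟨N, hN, hSN, hf⟩ := ih (by omega)
      obtain ⟨N', hN', hSN', hf'⟩ :=
        hN.exists_exchange hmono hsub hSN (ha ⟨i, hi⟩) (hb ⟨i, hi⟩)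
      have hsucc := prefixSet_succ e ⟨i, hi⟩
      dsimp only at hsucc hSN' hf'
      rw [← hsucc] at hSN' hf'
      exact ⟨N', hN', hSN', by linarith⟩
  obtain ⟨N, hN, hMN, hf⟩ := key k le_rfl
  rw [prefixSet_self, ← hM] at hMN hf
  have hNM : N ⊆ M := fun x hx => by
    by_contra hxM
    exact hMmax x ⟨hN.1 hx, hxM,
      hN.subset (Finset.union_subset hMN (Finset.singleton_subset_iff.2 hx))⟩
  rw [hNM.antisymm hMN] at hf
  linarith
end
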